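/- Let F, ξ : ℝ² → ℂ be C¹, r ∈ ℝ, and suppose D = ∂⁻F·conj(∂⁻F) − ∂⁺F·conj(∂⁺F) ≠ 0 at a point (u,v). Define α = conj(∂⁺F)·(1+ξconj(ξ))/(√2·D), β = −conj(∂⁻F)·(1+ξconj(ξ))/(√2·D), and E = α·Z₊ + β·Z₋ ∈ ℂ³. Then ⟨E, E⟩ = 0, ⟨E, conj(E)⟩ = 1, and ⟨W, E⟩ = 0, i.e. {W, E, conj(E)} is a null frame adapted to the congruence. -/

import Mathlib

open Complex
open scoped ComplexConjugate

/-- Wirtinger derivative ∂ = (1/2)(∂/∂u − i ∂/∂v). -/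
noncomputable def wd (f : ℝ × ℝ → ℂ) (p : ℝ × ℝ) : ℂ :=
  (1 / 2) * (fderiv ℝ f p (1, 0) - Complex.I * fderiv ℝ f p (0, 1))

/-- Wirtinger derivative ∂̄ = (1/2)(∂/∂u + i ∂/∂v). -/
noncomputable def wdb (f : ℝ × ℝ → ℂ) (p : ℝ × ℝ) : ℂ :=
  (1 / 2) * (fderiv ℝ f p (1, 0) + Complex.I * fderiv ℝ f p (0, 1))

/-- ∂⁺F = ∂F + r·∂ξ − 2F·conj(ξ)·∂ξ/(1+ξ·conj(ξ)). -/
noncomputable def dplus (F ξ : ℝ × ℝ → ℂ) (r : ℝ) (p : ℝ × ℝ) : ℂ :=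
  wd F p + r * wd ξ p - 2 * F p * conj (ξ p) * wd ξ p / (1 + ξ p * conj (ξ p))

/-- ∂⁻F = ∂̄F + r·∂̄ξ − 2F·conj(ξ)·∂̄ξ/(1+ξ·conj(ξ)). -/
noncomputable def dminus (F ξ : ℝ × ℝ → ℂ) (r : ℝ) (p : ℝ × ℝ) : ℂ :=
  wdb F p + r * wdb ξ p - 2 * F p * conj (ξ p) * wdb ξ p / (1 + ξ p * conj (ξ p))

/-- The ℂ-bilinear extension of the Euclidean inner product of ℝ³ to ℂ³. -/
noncomputable def bil (v w : Fin 3 → ℂ) : ℂ := v 0 * w 0 + v 1 * w 1 + v 2 * w 2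

/-- The direction vector W(ξ) ∈ ℝ³ ⊂ ℂ³. -/
noncomputable def Wvec (ξ : ℂ) : Fin 3 → ℂ :=
  ![(ξ + conj ξ) / (1 + ξ * conj ξ),
    -Complex.I * (ξ - conj ξ) / (1 + ξ * conj ξ),
    (1 - ξ * conj ξ) / (1 + ξ * conj ξ)]

/-- z = (2(F − conj(F)ξ²) + 2ξ(1+ξconj(ξ))r)/(1+ξconj(ξ))². -/
noncomputable def zC (F ξ : ℝ × ℝ → ℂ) (p : ℝ × ℝ) (r : ℝ) : ℂ :=
  (2 * (F p - conj (F p) * (ξ p) ^ 2) + 2 * ξ p * (1 + ξ p * conj (ξ p)) * r) /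
    (1 + ξ p * conj (ξ p)) ^ 2

/-- t = (−2(F·conj(ξ) + conj(F)·ξ) + (1 − ξ²conj(ξ)²)r)/(1+ξconj(ξ))². -/
noncomputable def tC (F ξ : ℝ × ℝ → ℂ) (p : ℝ × ℝ) (r : ℝ) : ℂ :=
  (-2 * (F p * conj (ξ p) + conj (F p) * ξ p) + (1 - (ξ p) ^ 2 * (conj (ξ p)) ^ 2) * r) /
    (1 + ξ p * conj (ξ p)) ^ 2

/-- Φ(u,v,r) = (x¹, x², x³) ∈ ℝ³ regarded as a vector in ℂ³ (its components are real). -/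
noncomputable def PhiC (F ξ : ℝ × ℝ → ℂ) (r : ℝ) (q : ℝ × ℝ) : Fin 3 → ℂ :=
  ![(zC F ξ q r + conj (zC F ξ q r)) / 2,
    (zC F ξ q r - conj (zC F ξ q r)) / (2 * Complex.I),
    tC F ξ q r]

/-- The Wirtinger derivative ∂Φ ∈ ℂ³ (componentwise, r held fixed). -/
noncomputable def dPhi (F ξ : ℝ × ℝ → ℂ) (r : ℝ) (p : ℝ × ℝ) : Fin 3 → ℂ :=
  fun i => wd (fun q => PhiC F ξ r q i) p

/-- The Wirtinger derivative ∂̄Φ ∈ ℂ³. -/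
noncomputable def dbPhi (F ξ : ℝ × ℝ → ℂ) (r : ℝ) (p : ℝ × ℝ) : Fin 3 → ℂ :=
  fun i => wdb (fun q => PhiC F ξ r q i) p

/-- Z₊ = ∂Φ − ⟨W, ∂Φ⟩·W. -/
noncomputable def Zp (F ξ : ℝ × ℝ → ℂ) (r : ℝ) (p : ℝ × ℝ) : Fin 3 → ℂ :=
  fun i => dPhi F ξ r p i - bil (Wvec (ξ p)) (dPhi F ξ r p) * Wvec (ξ p) i

/-- Z₋ = ∂̄Φ − ⟨W, ∂̄Φ⟩·W. -/
noncomputable def Zm (F ξ : ℝ × ℝ → ℂ) (r : ℝ) (p : ℝ × ℝ) : Fin 3 → ℂ :=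
  fun i => dbPhi F ξ r p i - bil (Wvec (ξ p)) (dbPhi F ξ r p) * Wvec (ξ p) i


/-- D = ∂⁻F·conj(∂⁻F) − ∂⁺F·conj(∂⁺F). -/
noncomputable def Dq (F ξ : ℝ × ℝ → ℂ) (r : ℝ) (p : ℝ × ℝ) : ℂ :=
  dminus F ξ r p * conj (dminus F ξ r p) - dplus F ξ r p * conj (dplus F ξ r p)

/-- α = conj(∂⁺F)·(1+ξconj(ξ))/(√2·D). -/
noncomputable def alphaC (F ξ : ℝ × ℝ → ℂ) (r : ℝ) (p : ℝ × ℝ) : ℂ :=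
  conj (dplus F ξ r p) * (1 + ξ p * conj (ξ p)) / ((Real.sqrt 2 : ℂ) * Dq F ξ r p)

/-- β = −conj(∂⁻F)·(1+ξconj(ξ))/(√2·D). -/
noncomputable def betaC (F ξ : ℝ × ℝ → ℂ) (r : ℝ) (p : ℝ × ℝ) : ℂ :=
  -(conj (dminus F ξ r p) * (1 + ξ p * conj (ξ p))) / ((Real.sqrt 2 : ℂ) * Dq F ξ r p)

/-- E = α·Z₊ + β·Z₋. -/
noncomputable def Efr (F ξ : ℝ × ℝ → ℂ) (r : ℝ) (p : ℝ × ℝ) : Fin 3 → ℂ :=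
  fun i => alphaC F ξ r p * Zp F ξ r p i + betaC F ξ r p * Zm F ξ r p i

/-- The derivative `∂W/∂ξ` of the direction vector, a null vector orthogonal to `W`. -/
noncomputable def Xvec (ξ : ℂ) : Fin 3 → ℂ :=
  ![(1 - conj ξ ^ 2) / (1 + ξ * conj ξ) ^ 2,
    -Complex.I * (1 + conj ξ ^ 2) / (1 + ξ * conj ξ) ^ 2,
    -2 * conj ξ / (1 + ξ * conj ξ) ^ 2]

lemma one_add_mul_conj_ne_zero (x : ℂ) : 1 + x * conj x ≠ 0 := by
  rw [mul_conj]
  norm_cast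
  have := normSq_nonneg x
  positivity

lemma bil_Wvec_self (x : ℂ) : bil (Wvec x) (Wvec x) = 1 := by
  have h := one_add_mul_conj_ne_zero x
  simp only [bil, Wvec, Matrix.cons_val]
  field_simp
  ring_nf
  simp only [I_sq]
  ring

lemma bil_Wvec_Xvec (x : ℂ) : bil (Wvec x) (Xvec x) = 0 := by
  have h := one_add_mul_conj_ne_zero x
  simp only [bil, Wvec, Xvec, Matrix.cons_val]
  field_simp
  ring_nf
  simp only [I_sq]
  ring

lemma bil_Wvec_conj_Xvec (x : ℂ) : bil (Wvec x) (fun i => conj (Xvec x i)) = 0 := by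
  have h := one_add_mul_conj_ne_zero x
  simp only [bil, Wvec, Xvec, Matrix.cons_val, map_div₀, map_mul, map_add, map_sub, map_neg,
    map_pow, map_one, map_ofNat, conj_conj, conj_I, mul_comm (conj x) x]
  field_simp
  ring_nf
  simp only [I_sq]
  ring

lemma bil_Xvec_self (x : ℂ) : bil (Xvec x) (Xvec x) = 0 := by
  have h := one_add_mul_conj_ne_zero x
  simp only [bil, Xvec, Matrix.cons_val]
  field_simp
  ring_nf
  simp only [I_sq]
  ring

lemma bil_Xvec_conj_Xvec (x : ℂ) :
    bil (Xvec x) (fun i => conj (Xvec x i)) = 2 / (1 + x * conj x) ^ 2 := by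
  have h := one_add_mul_conj_ne_zero x
  simp only [bil, Xvec, Matrix.cons_val, map_div₀, map_mul, map_add, map_sub, map_neg,
    map_pow, map_one, map_ofNat, conj_conj, conj_I, mul_comm (conj x) x]
  have h2 := pow_ne_zero 2 h
  simp only [div_mul_div_comm, ← add_div]
  rw [div_eq_div_iff (mul_ne_zero h2 h2) h2]
  linear_combination -(1 + conj x ^ 2) * (1 + x ^ 2) * (1 + x * conj x) ^ 2 * I_sq

lemma PhiC_eq (F ξ : ℝ × ℝ → ℂ) (r : ℝ) (q : ℝ × ℝ) (i : Fin 3) :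
    PhiC F ξ r q i =
      F q * Xvec (ξ q) i + conj (F q) * conj (Xvec (ξ q) i) + r * Wvec (ξ q) i := by
  have h := one_add_mul_conj_ne_zero (ξ q)
  fin_cases i <;>
  · simp only [PhiC, zC, tC, Wvec, Xvec, Fin.zero_eta, Fin.mk_one, Fin.reduceFinMk,
      Matrix.cons_val, map_div₀, map_mul, map_add, map_sub, map_neg,
      map_pow, map_one, map_ofNat, conj_conj, conj_I, conj_ofReal, mul_comm (conj (ξ q)) (ξ q)]
    field_simp
    ring_nf
    try simp only [I_sq]
    try ring

lemma hasDerivAt_Wvec {x : ℝ → ℂ} {x' : ℂ} {s : ℝ} (hx : HasDerivAt x x' s) (i : Fin 3) :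
    HasDerivAt (fun t => Wvec (x t) i)
      (x' * Xvec (x s) i + conj x' * conj (Xvec (x s) i)) s := by
  have h := one_add_mul_conj_ne_zero (x s)
  have hc : HasDerivAt (fun t => conj (x t)) (conj x') s := hx.star
  have hden := (hx.fun_mul hc).const_add 1
  fin_cases i
  · refine ((hx.fun_add hc).fun_div hden h).congr_deriv ?_
    simp only [Xvec, Fin.zero_eta, Matrix.cons_val, map_div₀, map_mul, map_add, map_sub, map_pow,
      map_one, conj_conj, mul_comm (conj (x s)) (x s)]
    field_simp
    ring
  · refine (((hx.fun_sub hc).const_mul (-I)).fun_div hden h).congr_deriv ?_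
    simp only [Xvec, Fin.mk_one, Matrix.cons_val, map_div₀, map_mul, map_add, map_neg, map_pow,
      map_one, conj_conj, conj_I, mul_comm (conj (x s)) (x s)]
    field_simp
    ring
  · refine (((hx.fun_mul hc).const_sub 1).fun_div hden h).congr_deriv ?_
    simp only [Xvec, Fin.reduceFinMk, Matrix.cons_val, map_div₀, map_mul, map_add, map_neg,
      map_pow, map_one, map_ofNat, conj_conj, mul_comm (conj (x s)) (x s)]
    field_simp
    ring

lemma hasDerivAt_Xvec {x : ℝ → ℂ} {x' : ℂ} {s : ℝ} (hx : HasDerivAt x x' s) (i : Fin 3) :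
    HasDerivAt (fun t => Xvec (x t) i)
      (-(2 * conj (x s) * x' / (1 + x s * conj (x s))) * Xvec (x s) i
        - 2 * conj x' / (1 + x s * conj (x s)) ^ 2 * Wvec (x s) i) s := by
  have h := one_add_mul_conj_ne_zero (x s)
  have h2 := pow_ne_zero 2 h
  have hc : HasDerivAt (fun t => conj (x t)) (conj x') s := hx.star
  have hden := ((hx.fun_mul hc).const_add 1).fun_pow 2
  fin_cases i
  · refine (((hc.fun_pow 2).const_sub 1).fun_div hden h2).congr_deriv ?_
    simp only [Xvec, Wvec, Fin.zero_eta, Matrix.cons_val]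
    field_simp
    ring
  · refine ((((hc.fun_pow 2).const_add 1).const_mul (-I)).fun_div hden h2).congr_deriv ?_
    simp only [Xvec, Wvec, Fin.mk_one, Matrix.cons_val]
    field_simp
    ring
  · refine ((hc.const_mul (-2)).fun_div hden h2).congr_deriv ?_
    simp only [Xvec, Wvec, Fin.reduceFinMk, Matrix.cons_val]
    field_simp
    ring

lemma conj_Wvec (x : ℂ) (i : Fin 3) : conj (Wvec x i) = Wvec x i := by
  fin_cases i
  · simp [Wvec, add_comm, mul_comm]
  · simp only [Wvec, Fin.mk_one, Matrix.cons_val, map_div₀, map_mul, map_add, map_sub, map_neg,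
      map_one, conj_conj, conj_I, mul_comm (conj x) x]
    ring
  · simp [Wvec, mul_comm]

lemma differentiableAt_PhiC {F ξ : ℝ × ℝ → ℂ} {p : ℝ × ℝ} (hF : DifferentiableAt ℝ F p)
    (hξ : DifferentiableAt ℝ ξ p) (r : ℝ) (i : Fin 3) :
    DifferentiableAt ℝ (fun q => PhiC F ξ r q i) p := by
  have h := one_add_mul_conj_ne_zero (ξ p)
  have hFc : DifferentiableAt ℝ (fun q => conj (F q)) p := hF.star
  have hξc : DifferentiableAt ℝ (fun q => conj (ξ q)) p := hξ.star
  have hz : DifferentiableAt ℝ (fun q => zC F ξ q r) p := by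
    simp only [zC, div_eq_mul_inv]
    fun_prop (disch := exact pow_ne_zero 2 h)
  have hzc : DifferentiableAt ℝ (fun q => conj (zC F ξ q r)) p := hz.star
  fin_cases i
  · change DifferentiableAt ℝ (fun q => (zC F ξ q r + conj (zC F ξ q r)) / 2) p
    fun_prop (disch := simp)
  · change DifferentiableAt ℝ (fun q => (zC F ξ q r - conj (zC F ξ q r)) / (2 * I)) p
    fun_prop (disch := simp)
  · change DifferentiableAt ℝ (fun q => tC F ξ q r) p
    simp only [tC, div_eq_mul_inv]
    fun_prop (disch := exact pow_ne_zero 2 h)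

lemma fderiv_PhiC {F ξ : ℝ × ℝ → ℂ} {p : ℝ × ℝ} (hF : DifferentiableAt ℝ F p)
    (hξ : DifferentiableAt ℝ ξ p) (r : ℝ) (i : Fin 3) (w : ℝ × ℝ) :
    fderiv ℝ (fun q => PhiC F ξ r q i) p w =
      (fderiv ℝ F p w + r * fderiv ℝ ξ p w
          - 2 * F p * conj (ξ p) * fderiv ℝ ξ p w / (1 + ξ p * conj (ξ p))) * Xvec (ξ p) i
        + conj (fderiv ℝ F p w + r * fderiv ℝ ξ p w
          - 2 * F p * conj (ξ p) * fderiv ℝ ξ p w / (1 + ξ p * conj (ξ p)))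
            * conj (Xvec (ξ p) i)
        - 2 * (F p * conj (fderiv ℝ ξ p w) + conj (F p) * fderiv ℝ ξ p w)
          / (1 + ξ p * conj (ξ p)) ^ 2 * Wvec (ξ p) i := by
  have hF' : HasDerivAt (fun t : ℝ => F (p + t • w)) (fderiv ℝ F p w) 0 :=
    hF.hasFDerivAt.hasLineDerivAt w
  have hξ' : HasDerivAt (fun t : ℝ => ξ (p + t • w)) (fderiv ℝ ξ p w) 0 :=
    hξ.hasFDerivAt.hasLineDerivAt w
  have hX := hasDerivAt_Xvec hξ' i
  have hFc : HasDerivAt (fun t : ℝ => conj (F (p + t • w))) _ 0 := hF'.star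
  have hXc : HasDerivAt (fun t : ℝ => conj (Xvec (ξ (p + t • w)) i)) _ 0 := hX.star
  have key := ((hF'.fun_mul hX).fun_add (hFc.fun_mul hXc)).fun_add
    ((hasDerivAt_Wvec hξ' i).const_mul (r : ℂ))
  have hΦ : HasDerivAt (fun t : ℝ => PhiC F ξ r (p + t • w) i) _ 0 :=
    (differentiableAt_PhiC hF hξ r i).hasFDerivAt.hasLineDerivAt w
  simp only [PhiC_eq F ξ r (p + _ • w) i] at hΦ
  rw [hΦ.unique key]
  simp only [zero_smul, add_zero, star_def, map_div₀, map_mul, map_add, map_sub, map_neg,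
    map_pow, map_one, map_ofNat, conj_conj, conj_ofReal, conj_Wvec,
    mul_comm (conj (ξ p)) (ξ p)]
  ring

section WirtingerPhi

variable {F ξ : ℝ × ℝ → ℂ} {p : ℝ × ℝ}

lemma dPhi_eq (hF : DifferentiableAt ℝ F p) (hξ : DifferentiableAt ℝ ξ p) (r : ℝ) :
    ∃ c : ℂ, ∀ i, dPhi F ξ r p i = dplus F ξ r p * Xvec (ξ p) i
      + conj (dminus F ξ r p) * conj (Xvec (ξ p) i) + c * Wvec (ξ p) i := by
  refine ⟨-2 * (F p * conj (wdb ξ p) + conj (F p) * wd ξ p) / (1 + ξ p * conj (ξ p)) ^ 2,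
    fun i => ?_⟩
  simp only [dPhi, dplus, dminus, wd, wdb, fderiv_PhiC hF hξ]
  simp only [map_div₀, map_mul, map_add, map_sub, map_one, map_ofNat, conj_conj, conj_I,
    conj_ofReal, mul_comm (conj (ξ p)) (ξ p)]
  ring

lemma dbPhi_eq (hF : DifferentiableAt ℝ F p) (hξ : DifferentiableAt ℝ ξ p) (r : ℝ) :
    ∃ c : ℂ, ∀ i, dbPhi F ξ r p i = dminus F ξ r p * Xvec (ξ p) i
      + conj (dplus F ξ r p) * conj (Xvec (ξ p) i) + c * Wvec (ξ p) i := by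
  refine ⟨-2 * (F p * conj (wd ξ p) + conj (F p) * wdb ξ p) / (1 + ξ p * conj (ξ p)) ^ 2,
    fun i => ?_⟩
  simp only [dbPhi, dplus, dminus, wd, wdb, fderiv_PhiC hF hξ]
  simp only [map_div₀, map_mul, map_add, map_sub, map_one, map_ofNat, conj_conj, conj_I,
    conj_ofReal, mul_comm (conj (ξ p)) (ξ p)]
  ring

/-- Removing the `W` component leaves the components along `∂W/∂ξ` and its conjugate. -/
lemma sub_bil_Wvec_mul {x a b c : ℂ} {V : Fin 3 → ℂ}
    (hV : ∀ i, V i = a * Xvec x i + b * conj (Xvec x i) + c * Wvec x i) (i : Fin 3) :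
    V i - bil (Wvec x) V * Wvec x i = a * Xvec x i + b * conj (Xvec x i) := by
  have hc : bil (Wvec x) V = c := by
    have h₁ := bil_Wvec_self x
    have h₂ := bil_Wvec_Xvec x
    have h₃ := bil_Wvec_conj_Xvec x
    simp only [bil] at h₁ h₂ h₃ ⊢
    rw [hV, hV, hV]
    linear_combination a * h₂ + b * h₃ + c * h₁
  rw [hc, hV]
  ring

lemma Efr_eq (hF : DifferentiableAt ℝ F p) (hξ : DifferentiableAt ℝ ξ p) (r : ℝ)
    (hD : Dq F ξ r p ≠ 0) (i : Fin 3) :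
    Efr F ξ r p i = -((1 + ξ p * conj (ξ p)) / (Real.sqrt 2 : ℂ)) * Xvec (ξ p) i := by
  obtain ⟨c, hc⟩ := dPhi_eq hF hξ r
  obtain ⟨d, hd⟩ := dbPhi_eq hF hξ r
  have h2 : (Real.sqrt 2 : ℂ) ≠ 0 := by simp
  simp only [Efr, Zp, Zm, sub_bil_Wvec_mul hc, sub_bil_Wvec_mul hd, alphaC, betaC]
  field_simp
  rw [Dq]
  ring

end WirtingerPhi

/-- Where D ≠ 0, {W, E, conj(E)} is a null frame adapted to the congruence:
⟨E,E⟩ = 0, ⟨E,conj(E)⟩ = 1, ⟨W,E⟩ = 0. -/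
theorem adapted_null_frame
    (F ξ : ℝ × ℝ → ℂ) (hF : ContDiff ℝ 1 F) (hξ : ContDiff ℝ 1 ξ)
    (r : ℝ) (p : ℝ × ℝ) (hD : Dq F ξ r p ≠ 0) :
    bil (Efr F ξ r p) (Efr F ξ r p) = 0 ∧
    bil (Efr F ξ r p) (fun i => conj (Efr F ξ r p i)) = 1 ∧
    bil (Wvec (ξ p)) (Efr F ξ r p) = 0 := by
  have hE := Efr_eq (hF.differentiable one_ne_zero p) (hξ.differentiable one_ne_zero p) r hD
  have h := one_add_mul_conj_ne_zero (ξ p)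
  have h2 : (Real.sqrt 2 : ℂ) ≠ 0 := by simp
  have hsq : (Real.sqrt 2 : ℂ) ^ 2 = 2 := by
    norm_cast
    simp
  have hXX := bil_Xvec_self (ξ p)
  have hXc := bil_Xvec_conj_Xvec (ξ p)
  have hWX := bil_Wvec_Xvec (ξ p)
  simp only [bil, hE, map_mul, map_neg, map_div₀, map_add, map_one, conj_conj, conj_ofReal,
    mul_comm (conj (ξ p)) (ξ p)] at hXX hXc hWX ⊢
  set k := (1 + ξ p * conj (ξ p)) / (Real.sqrt 2 : ℂ) with hk
  refine ⟨by linear_combination k ^ 2 * hXX, ?_, by linear_combination -k * hWX⟩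
  have hkk : k ^ 2 * (2 / (1 + ξ p * conj (ξ p)) ^ 2) = 1 := by
    rw [hk, div_pow, hsq]
    field_simp
  linear_combination k ^ 2 * hXc + hkk
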